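/- Let ε₁, δ ∈ (0,1). There exist constants Φ₀ > 0 and C > 0, depending only on ε₁ and δ, with the following property. For every Φ ≥ Φ₀, every integer n with 1 ≤ |n| ≤ ε₁·√Φ, every α ≥ 0 with δ·(Φ·|n|)^{1/3} ≤ 4+α ≤ δ⁻¹·(Φ·|n|)^{1/3}, and every smooth solution ψ of the n-th mode problem with Navier boundary conditions with right-hand side f = i·n·F^r − (F^z)', writing ‖F*‖² = ∫₀¹ (|F^r|² + |F^z|²)·r dr, one has: (i) ∫₀¹ |ψ|²·r dr ≤ C·(Φ·|n|)^{−5/3}·‖F*‖²; (ii) ∫₀¹ |(d/dr)(r·ψ)|²·(1/r) dr + n²·∫₀¹ |ψ|²·r dr ≤ C·(Φ·|n|)^{−4/3}·‖F*‖²; (iii) |n|·∫₀¹ Ū(r)·|(d/dr)(r·ψ)|²·(1/r) dr + |n|³·∫₀¹ Ū(r)·|ψ|²·r dr ≤ C·(Φ·|n|)^{−2/3}·‖F*‖²; (iv) ∫₀¹ |𝓛ψ|²·r dr + n²·∫₀¹ |(d/dr)(r·ψ)|²·(1/r) dr + n⁴·∫₀¹ |ψ|²·r dr + α·|ψ'(1)|²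 ≤ C·(Φ·|n|)^{−1/2}·‖F*‖². (Proposition 3.7: the case of large flux, intermediate frequency and intermediate slip coefficient.) -/

import Mathlib

open MeasureTheory Filter

/-- One-sided derivative on `(0,1]`. -/
noncomputable def dz (g : ℝ → ℂ) : ℝ → ℂ := derivWithin g (Set.Ioc 0 1)

/-- The operator `(𝓛 g)(r) = g''(r) + (1/r) g'(r) − (1/r²) g(r)`. -/
noncomputable def Lop (g : ℝ → ℂ) : ℝ → ℂ := fun r =>
  dz (dz g) r + ((r : ℂ))⁻¹ * dz g r - (((r : ℂ)) ^ 2)⁻¹ * g r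

/-- Weighted integral over `(0,1)` with values in `[0,∞]`. -/
noncomputable def wInt (h : ℝ → ℝ) : ENNReal :=
  ∫⁻ r in Set.Ioo (0 : ℝ) 1, ENNReal.ofReal (h r)

/-- The Poiseuille profile `Ū(r) = ((4+2α)/(4+α)) (1 − (2α/(4+2α)) r²) (Φ/π)`. -/
noncomputable def Ubar (Φ α : ℝ) : ℝ → ℝ := fun r =>
  (4 + 2 * α) / (4 + α) * (1 - 2 * α / (4 + 2 * α) * r ^ 2) * (Φ / Real.pi)

/-- A smooth solution of the `n`-th mode problem with Navier boundary conditions: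
`ψ` is four times continuously differentiable on `(0,1]`; `ψ`, `ψ'`, `𝓛ψ` and
`(d/dr)(r 𝓛ψ)` extend continuously to `[0,1]`;
`i n Ū (𝓛−n²)ψ − (𝓛−n²)²ψ = f` on `(0,1)`; `ψ(0) = ψ(1) = (𝓛ψ)(0) = 0` and
`(𝓛ψ)(1) = −α ψ'(1)`; and the relevant weighted integrals are finite. -/
structure NavierSol (Φ α : ℝ) (n : ℤ) (f ψ : ℝ → ℂ) : Prop where
  smooth : ContDiffOn ℝ 4 ψ (Set.Ioc 0 1)
  /-- `ψ` extends continuously to `[0,1]` with `ψ(0) = 0`. -/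
  ext_psi : Filter.Tendsto ψ (nhdsWithin (0 : ℝ) (Set.Ioc 0 1)) (nhds (0 : ℂ))
  /-- `ψ'` extends continuously to `[0,1]`. -/
  ext_dpsi : ∃ L : ℂ, Filter.Tendsto (dz ψ) (nhdsWithin (0 : ℝ) (Set.Ioc 0 1)) (nhds L)
  /-- `𝓛ψ` extends continuously to `[0,1]` with `(𝓛ψ)(0) = 0`. -/
  ext_Lpsi : Filter.Tendsto (Lop ψ) (nhdsWithin (0 : ℝ) (Set.Ioc 0 1)) (nhds (0 : ℂ))
  /-- `(d/dr)(r 𝓛ψ)` extends continuously to `[0,1]`. -/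
  ext_dLpsi : ∃ L : ℂ, Filter.Tendsto (dz (fun r => (r : ℂ) * Lop ψ r))
    (nhdsWithin (0 : ℝ) (Set.Ioc 0 1)) (nhds L)
  bc_psi : ψ 1 = 0
  bc_navier : Lop ψ 1 = -(α : ℂ) * dz ψ 1
  eqn : ∀ r ∈ Set.Ioo (0 : ℝ) 1,
    Complex.I * (n : ℂ) * (Ubar Φ α r : ℂ) * (Lop ψ r - (n : ℂ) ^ 2 * ψ r)
      - (Lop (fun s => Lop ψ s - (n : ℂ) ^ 2 * ψ s) r
          - (n : ℂ) ^ 2 * (Lop ψ r - (n : ℂ) ^ 2 * ψ r)) = f r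
  fin_psi : wInt (fun r => ‖ψ r‖ ^ 2 * r) < ⊤
  fin_dpsi : wInt (fun r => ‖dz (fun s => (s : ℂ) * ψ s) r‖ ^ 2 / r) < ⊤
  fin_Lpsi : wInt (fun r => ‖Lop ψ r‖ ^ 2 * r) < ⊤
  fin_dLpsi : wInt (fun r => ‖dz (fun s => (s : ℂ) * Lop ψ s) r‖ ^ 2 / r) < ⊤
  fin_LLpsi : wInt (fun r => ‖Lop (Lop ψ) r‖ ^ 2 * r) < ⊤


/-- continuous on `(0,1]` and bounded there -/
def BC {E : Type*} [NormedRing E] (h : ℝ → E) : Prop :=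
  ContinuousOn h (Set.Ioc 0 1) ∧ ∃ M : ℝ, ∀ r ∈ Set.Ioc (0:ℝ) 1, ‖h r‖ ≤ M

section BCsec
variable {E : Type*} [NormedRing E]

theorem BC.mul {f g : ℝ → E} (hf : BC f) (hg : BC g) : BC (fun r => f r * g r) := by
  obtain ⟨cf, M, hM⟩ := hf
  obtain ⟨cg, M', hM'⟩ := hg
  refine ⟨cf.mul cg, M * M', fun r hr => (norm_mul_le _ _).trans ?_⟩
  exact mul_le_mul (hM r hr) (hM' r hr) (norm_nonneg _) ((norm_nonneg _).trans (hM r hr))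

theorem BC.add {f g : ℝ → E} (hf : BC f) (hg : BC g) : BC (fun r => f r + g r) := by
  obtain ⟨cf, M, hM⟩ := hf
  obtain ⟨cg, M', hM'⟩ := hg
  exact ⟨cf.add cg, M + M', fun r hr => (norm_add_le _ _).trans (add_le_add (hM r hr) (hM' r hr))⟩

theorem BC.sub {f g : ℝ → E} (hf : BC f) (hg : BC g) : BC (fun r => f r - g r) := by
  obtain ⟨cf, M, hM⟩ := hf
  obtain ⟨cg, M', hM'⟩ := hg
  exact ⟨cf.sub cg, M + M', fun r hr => (norm_sub_le _ _).trans (add_le_add (hM r hr) (hM' r hr))⟩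

theorem BC.const (c : E) : BC (fun _ => c) := ⟨continuousOn_const, ‖c‖, fun _ _ => le_rfl⟩

theorem BC.norm {f : ℝ → E} (hf : BC f) : BC (fun r => ‖f r‖) := by
  obtain ⟨cf, M, hM⟩ := hf
  exact ⟨cf.norm, M, fun r hr => by simpa using hM r hr⟩

theorem BC.pow {f : ℝ → E} (hf : BC f) : BC (fun r => f r ^ 2) := by
  simpa [sq] using hf.mul hf

theorem BC.of_cont {f : ℝ → E} (hf : ContinuousOn f (Set.Icc 0 1)) : BC f := by
  obtain ⟨M, hM⟩ := isCompact_Icc.exists_bound_of_continuousOn hf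
  exact ⟨hf.mono Set.Ioc_subset_Icc_self, M, fun r hr => hM r (Set.Ioc_subset_Icc_self hr)⟩

theorem BC.of_tendsto {f : ℝ → E} (hf : ContinuousOn f (Set.Ioc 0 1)) {L : E}
    (ht : Tendsto f (nhdsWithin (0 : ℝ) (Set.Ioc 0 1)) (nhds L)) : BC f := by
  refine ⟨hf, ?_⟩
  rw [nhdsWithin_Ioc_eq_nhdsGT one_pos] at ht
  have h1 : ∀ᶠ r in nhdsWithin (0:ℝ) (Set.Ioi 0), ‖f r‖ < ‖L‖ + 1 :=
    ht.norm.eventually (gt_mem_nhds (by linarith))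
  obtain ⟨a, ha, ha'⟩ := mem_nhdsGT_iff_exists_Ioo_subset.1 h1
  have ha0 : (0:ℝ) < a := ha
  obtain ⟨M, hM⟩ := (isCompact_Icc (a := a) (b := (1:ℝ))).exists_bound_of_continuousOn
    (hf.mono (fun x hx => ⟨ha0.trans_le hx.1, hx.2⟩))
  refine ⟨max M (‖L‖ + 1), fun r hr => ?_⟩
  by_cases h : r < a
  · exact (le_of_lt (ha' ⟨hr.1, h⟩)).trans (le_max_right _ _)
  · exact (hM r ⟨not_lt.1 h, hr.2⟩).trans (le_max_left _ _)

end BCsec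

theorem BC.integrable {E : Type*} [NormedRing E] [NormedSpace ℝ E] {f : ℝ → E} (hf : BC f) :
    IntervalIntegrable f volume 0 1 := by
  obtain ⟨cf, M, hM⟩ := hf
  rw [intervalIntegrable_iff_integrableOn_Ioc_of_le zero_le_one]
  refine ⟨cf.aestronglyMeasurable measurableSet_Ioc, ?_⟩
  refine HasFiniteIntegral.restrict_of_bounded M (by simp) ?_
  exact (ae_restrict_iff' measurableSet_Ioc).2 (Eventually.of_forall hM)

theorem BC.conj {f : ℝ → ℂ} (hf : BC f) : BC (fun r => (starRingEnd ℂ) (f r)) := by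
  obtain ⟨cf, M, hM⟩ := hf
  exact ⟨Complex.continuous_conj.comp_continuousOn cf, M, fun r hr => by simpa using hM r hr⟩

theorem BC.ofReal {f : ℝ → ℝ} (hf : BC f) : BC (fun r => (f r : ℂ)) := by
  obtain ⟨cf, M, hM⟩ := hf
  exact ⟨Complex.continuous_ofReal.comp_continuousOn cf, M, fun r hr => by simpa using hM r hr⟩

theorem BC.id : BC (fun r : ℝ => r) := BC.of_cont continuousOn_id

/-- `f` tends to `0` at `0+`. -/
def Z0 (f : ℝ → ℂ) : Prop := Tendsto f (nhdsWithin (0 : ℝ) (Set.Ioi 0)) (nhds 0)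

theorem Z0.mul {f g : ℝ → ℂ} (hf : Z0 f) (hg : BC g) : Z0 (fun r => f r * g r) := by
  obtain ⟨_, M, hM⟩ := hg
  unfold Z0
  rw [← nhdsWithin_Ioc_eq_nhdsGT one_pos]
  have h0 : Tendsto (fun r => ‖f r‖ * M) (nhdsWithin (0 : ℝ) (Set.Ioc 0 1)) (nhds 0) := by
    unfold Z0 at hf
    rw [← nhdsWithin_Ioc_eq_nhdsGT one_pos] at hf
    simpa using hf.norm.mul_const M
  refine squeeze_zero_norm' ?_ h0
  filter_upwards [self_mem_nhdsWithin] with r hr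
  rw [norm_mul]
  exact mul_le_mul_of_nonneg_left (hM r hr) (norm_nonneg _)

theorem Z0.add {f g : ℝ → ℂ} (hf : Z0 f) (hg : Z0 g) : Z0 (fun r => f r + g r) := by
  unfold Z0; simpa using Tendsto.add hf hg

theorem Z0.sub {f g : ℝ → ℂ} (hf : Z0 f) (hg : Z0 g) : Z0 (fun r => f r - g r) := by
  unfold Z0; simpa using Tendsto.sub hf hg

theorem Z0.conj {f : ℝ → ℂ} (hf : Z0 f) : Z0 (fun r => (starRingEnd ℂ) (f r)) := by
  have := (Complex.continuous_conj.tendsto 0).comp hf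
  rw [map_zero] at this
  exact this

theorem Z0.id : Z0 (fun r => (r : ℂ)) := by
  have : Tendsto (fun r : ℝ => (r : ℂ)) (nhds 0) (nhds ((0:ℝ):ℂ)) :=
    Complex.continuous_ofReal.tendsto 0
  simpa [Z0] using this.mono_left nhdsWithin_le_nhds

theorem ftc0 {G g : ℝ → ℂ} (hG : ContinuousOn G (Set.Ioc 0 1))
    (hd : ∀ r ∈ Set.Ioo (0:ℝ) 1, HasDerivAt G (g r) r) (hg : BC g) (h0 : Z0 G) :
    ∫ r in (0:ℝ)..1, g r = G 1 := by
  have h1 : Tendsto G (nhdsWithin 1 (Set.Iio 1)) (nhds (G 1)) := by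
    have := (hG 1 (by simp)).mono (Set.Ioo_subset_Ioc_self)
    rw [ContinuousWithinAt, nhdsWithin_Ioo_eq_nhdsLT one_pos] at this
    exact this
  have := intervalIntegral.integral_eq_sub_of_hasDerivAt_of_tendsto one_pos hd hg.integrable h0 h1
  simpa using this

/-- Abstract data of the mode problem. -/
structure Data (m c u α : ℝ) (Fr Fz Fz1 ψ ψ1 P W W1 W2 : ℝ → ℂ) : Prop where
  cψ : ContinuousOn ψ (Set.Ioc 0 1)
  cψ1 : ContinuousOn ψ1 (Set.Ioc 0 1)
  cW1 : ContinuousOn W1 (Set.Ioc 0 1)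
  bW : BC W
  bFr : BC Fr
  bFz : BC Fz
  bψ1 : BC ψ1
  hP : ∀ r, P r = ψ1 r + (r : ℂ)⁻¹ * ψ r
  bP : BC P
  brW1 : BC (fun r => (r : ℂ) * W1 r)
  zψ : Z0 ψ
  dψ : ∀ r ∈ Set.Ioo (0:ℝ) 1, HasDerivAt ψ (ψ1 r) r
  dψ1 : ∀ r ∈ Set.Ioo (0:ℝ) 1, HasDerivAt ψ1
    (W r + (m:ℂ)^2 * ψ r - (r : ℂ)⁻¹ * ψ1 r + ((r : ℂ) ^ 2)⁻¹ * ψ r) r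
  dW : ∀ r ∈ Set.Ioo (0:ℝ) 1, HasDerivAt W (W1 r) r
  dW1 : ∀ r ∈ Set.Ioo (0:ℝ) 1, HasDerivAt W1 (W2 r) r
  dFz : ∀ r ∈ Set.Ioo (0:ℝ) 1, HasDerivAt Fz (Fz1 r) r
  ψ_one : ψ 1 = 0
  W_one : W 1 = - (α:ℂ) * ψ1 1
  eqn : ∀ r ∈ Set.Ioo (0:ℝ) 1,
    Complex.I * m * ((u - c * r ^ 2 / 2 : ℝ) : ℂ) * W r
     - (W2 r + (r:ℂ)⁻¹ * W1 r - ((r : ℂ) ^ 2)⁻¹ * W r - (m:ℂ)^2 * W r)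
     = Complex.I * m * Fr r - Fz1 r

section
variable {m c u α : ℝ} {Fr Fz Fz1 ψ ψ1 P W W1 W2 : ℝ → ℂ}

theorem Data.bψ (h : Data m c u α Fr Fz Fz1 ψ ψ1 P W W1 W2) : BC ψ := by
  refine BC.of_tendsto h.cψ (L := 0) ?_
  rw [nhdsWithin_Ioc_eq_nhdsGT one_pos]; exact h.zψ

local notation "cj" => starRingEnd ℂ

theorem hasDerivAt_ofReal' (r : ℝ) : HasDerivAt (fun s : ℝ => (s : ℂ)) 1 r :=
  Complex.ofRealCLM.hasDerivAt (x := r) |>.congr_deriv (by simp)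

theorem hasDerivAt_conj {f : ℝ → ℂ} {f' : ℂ} {r : ℝ} (hf : HasDerivAt f f' r) :
    HasDerivAt (fun s => cj (f s)) (cj f') r := by
  exact (Complex.conjCLE.toContinuousLinearMap.hasFDerivAt (x := f r)).comp_hasDerivAt r hf

theorem bU (u c : ℝ) : BC (fun r : ℝ => u - c * r ^ 2 / 2) :=
  BC.of_cont (by fun_prop)

theorem Data.main (h : Data m c u α Fr Fz Fz1 ψ ψ1 P W W1 W2) :
    ∫ r in (0:ℝ)..1, (Complex.I * m * (c * r ^ 2 * (P r * cj (ψ r))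
        - ((u - c * r ^ 2 / 2 : ℝ) : ℂ) * r * (P r * cj (P r))
        - m ^ 2 * ((u - c * r ^ 2 / 2 : ℝ) : ℂ) * r * (ψ r * cj (ψ r)))
      - r * (W r * cj (W r)) - Complex.I * m * r * (Fr r * cj (ψ r))
      - r * (Fz r * cj (P r)))
    = α * (ψ1 1 * cj (ψ1 1)) := by
  have bi : BC (fun r : ℝ => (r : ℂ)) := BC.id.ofReal
  have bU := (bU u c).ofReal
  have hc := fun x : ℂ => BC.const x
  rw [ftc0 (G := fun r => (r * W1 r) * cj (ψ r) - r * (W r * cj (ψ1 r)) - r * (Fz r * cj (ψ r))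
      - Complex.I * m * ((u - c * r ^ 2 / 2 : ℝ) : ℂ) * (r * (P r * cj (ψ r))))]
  · simp [h.ψ_one, h.W_one]; ring
  · exact ((((h.brW1.mul h.bψ.conj).sub (bi.mul (h.bW.mul h.bψ1.conj))).sub
      (bi.mul (h.bFz.mul h.bψ.conj))).sub (((hc _).mul bU).mul (bi.mul (h.bP.mul h.bψ.conj)))).1
  · intro r hr
    have hr0 : (r : ℂ) ≠ 0 := by exact_mod_cast hr.1.ne'
    have e := h.eqn r hr
    have dr := hasDerivAt_ofReal' r
    have dψ := h.dψ r hr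
    have dψ1 := h.dψ1 r hr
    have dW := h.dW r hr
    have dW1 := h.dW1 r hr
    have dFz := h.dFz r hr
    have dU : HasDerivAt (fun r : ℝ => ((u - c * r ^ 2 / 2 : ℝ) : ℂ)) (-(c * r)) r := by
      have : HasDerivAt (fun r : ℝ => u - c * r ^ 2 / 2) (-(c * r)) r :=
        ((((hasDerivAt_id r).pow 2).const_mul c).div_const 2).const_sub u |>.congr_deriv
          (by simp; ring)
      exact this.ofReal_comp.congr_deriv (by push_cast; ring)
    have dinv : HasDerivAt (fun s : ℝ => ((s : ℂ))⁻¹) (-1 / (r:ℂ)^2) r := dr.inv hr0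
    have dP : HasDerivAt P _ r := (dψ1.add (dinv.mul dψ)).congr_of_eventuallyEq
      (Eventually.of_forall (fun s => by simp [h.hP]))
    have key := ((((dr.mul dW1).mul (hasDerivAt_conj dψ)).sub (dr.mul (dW.mul (hasDerivAt_conj dψ1)))).sub
      (dr.mul (dFz.mul (hasDerivAt_conj dψ)))).sub
      ((dU.const_mul (Complex.I * m)).mul (dr.mul (dP.mul (hasDerivAt_conj dψ))))
    refine key.congr_deriv ?_
    have e2 : W2 r = Complex.I * m * ((u - c * r ^ 2 / 2 : ℝ) : ℂ) * W r
      - ((r:ℂ)⁻¹ * W1 r - ((r : ℂ) ^ 2)⁻¹ * W r - (m:ℂ)^2 * W r)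
      - (Complex.I * m * Fr r - Fz1 r) := by linear_combination -e
    rw [e2]
    simp only [h.hP, map_add, map_sub, map_mul, map_pow, map_inv₀, Complex.conj_ofReal, Pi.mul_apply]
    generalize ((u - c * r ^ 2 / 2 : ℝ) : ℂ) = U
    field_simp
    ring
  · refine BC.sub (BC.sub (BC.sub (((hc _)).mul (BC.sub (BC.sub (BC.mul (BC.mul (hc _) bi.pow) (h.bP.mul h.bψ.conj)) ((bU.mul bi).mul (h.bP.mul h.bP.conj))) ((((hc _).mul bU).mul bi).mul (h.bψ.mul h.bψ.conj))))
      (bi.mul (h.bW.mul h.bW.conj))) (((hc _).mul bi).mul (h.bFr.mul h.bψ.conj))) (bi.mul (h.bFz.mul h.bP.conj))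
  · have z1 : Z0 (fun r : ℝ => (r * W1 r) * cj (ψ r)) := by
      simpa only [mul_comm] using h.zψ.conj.mul h.brW1
    have z4 : Z0 (fun r : ℝ => Complex.I * m * ((u - c * r ^ 2 / 2 : ℝ) : ℂ) * (r * (P r * cj (ψ r)))) := by
      have := (Z0.id.mul (h.bP.mul h.bψ.conj)).mul ((hc (Complex.I * m)).mul bU)
      simpa only [mul_comm (_ * _ : ℂ) (Complex.I * _ * _)] using this
    exact ((z1.sub (Z0.id.mul (h.bW.mul h.bψ1.conj))).sub (Z0.id.mul (h.bFz.mul h.bψ.conj))).sub z4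

theorem BC.re {f : ℝ → ℂ} (hf : BC f) : BC (fun r => (f r).re) := by
  obtain ⟨cf, M, hM⟩ := hf
  exact ⟨Complex.continuous_re.comp_continuousOn cf, M, fun r hr =>
    (Complex.abs_re_le_norm _).trans (hM r hr)⟩

theorem BC.im {f : ℝ → ℂ} (hf : BC f) : BC (fun r => (f r).im) := by
  obtain ⟨cf, M, hM⟩ := hf
  exact ⟨Complex.continuous_im.comp_continuousOn cf, M, fun r hr =>
    (Complex.abs_im_le_norm _).trans (hM r hr)⟩

theorem re_int {f : ℝ → ℂ} (hf : BC f) :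
    ∫ r in (0:ℝ)..1, (f r).re = (∫ r in (0:ℝ)..1, f r).re :=
  Complex.reCLM.intervalIntegral_comp_comm hf.integrable

theorem im_int {f : ℝ → ℂ} (hf : BC f) :
    ∫ r in (0:ℝ)..1, (f r).im = (∫ r in (0:ℝ)..1, f r).im :=
  Complex.imCLM.intervalIntegral_comp_comm hf.integrable

theorem int_mono {f g : ℝ → ℝ} (hf : BC f) (hg : BC g)
    (hfg : ∀ r ∈ Set.Ioo (0:ℝ) 1, f r ≤ g r) :
    ∫ r in (0:ℝ)..1, f r ≤ ∫ r in (0:ℝ)..1, g r :=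
  intervalIntegral.integral_mono_on_of_le_Ioo zero_le_one hf.integrable hg.integrable hfg

theorem int_congr {E : Type*} [NormedAddCommGroup E] [NormedSpace ℝ E] {f g : ℝ → E}
    (hfg : ∀ r ∈ Set.Ioo (0:ℝ) 1, f r = g r) :
    ∫ r in (0:ℝ)..1, f r = ∫ r in (0:ℝ)..1, g r := by
  rw [intervalIntegral.integral_of_le zero_le_one, intervalIntegral.integral_of_le zero_le_one,
    integral_Ioc_eq_integral_Ioo, integral_Ioc_eq_integral_Ioo]
  exact setIntegral_congr_fun measurableSet_Ioo hfg

theorem Data.dP (h : Data m c u α Fr Fz Fz1 ψ ψ1 P W W1 W2) : ∀ r ∈ Set.Ioo (0:ℝ) 1,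
    HasDerivAt P (W r + (m:ℂ)^2 * ψ r) r := by
  intro r hr
  have hr0 : (r : ℂ) ≠ 0 := by exact_mod_cast hr.1.ne'
  have dinv : HasDerivAt (fun s : ℝ => ((s : ℂ))⁻¹) (-1 / (r:ℂ)^2) r :=
    (hasDerivAt_ofReal' r).inv hr0
  refine HasDerivAt.congr_deriv (((h.dψ1 r hr).add (dinv.mul (h.dψ r hr))).congr_of_eventuallyEq
      (Eventually.of_forall (fun s => by simp [h.hP]))) ?_
  field_simp
  ring

/-- `∫ r² Re(P ψ̄) = 0` -/
theorem Data.cross (h : Data m c u α Fr Fz Fz1 ψ ψ1 P W W1 W2) :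
    ∫ r in (0:ℝ)..1, r ^ 2 * (P r * cj (ψ r)).re = 0 := by
  have bi : BC (fun r : ℝ => (r : ℂ)) := BC.id.ofReal
  have bg : BC (fun r : ℝ => (r:ℂ)^2 * (P r * cj (ψ r) + ψ r * cj (P r))) :=
    bi.pow.mul ((h.bP.mul h.bψ.conj).add (h.bψ.mul h.bP.conj))
  have e := ftc0 (G := fun r => (r:ℂ)^2 * (ψ r * cj (ψ r)))
    (g := fun r => (r:ℂ)^2 * (P r * cj (ψ r) + ψ r * cj (P r)))
    (bi.pow.mul (h.bψ.mul h.bψ.conj)).1 ?_ bg ?_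
  · have e2 := re_int bg
    rw [e] at e2
    simp only [h.ψ_one, zero_mul, mul_zero, Complex.zero_re] at e2
    have : ∫ r in (0:ℝ)..1, r ^ 2 * (P r * cj (ψ r)).re
        = ∫ r in (0:ℝ)..1, (1/2) * ((r:ℂ)^2 * (P r * cj (ψ r) + ψ r * cj (P r))).re := by
      congr 1; ext r
      rw [← Complex.ofReal_pow, Complex.re_ofReal_mul]
      simp
      ring
    rw [this, intervalIntegral.integral_const_mul, e2, mul_zero]
  · intro r hr
    have hr0 : (r : ℂ) ≠ 0 := by exact_mod_cast hr.1.ne'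
    have dψ := h.dψ r hr
    refine (((hasDerivAt_ofReal' r).pow 2).mul (dψ.mul (hasDerivAt_conj dψ))).congr_deriv ?_
    simp only [h.hP, map_add, map_mul, map_inv₀, Complex.conj_ofReal, Pi.mul_apply, Pi.pow_apply]
    field_simp
    push_cast
    ring
  · have := Z0.id.mul (bi.mul (h.bψ.mul h.bψ.conj))
    simpa only [sq, mul_assoc] using this

/-- `∫ r Re(W ψ̄) = -m² ∫|ψ|² r - ∫ |P|² r` -/
theorem Data.expand (h : Data m c u α Fr Fz Fz1 ψ ψ1 P W W1 W2) :
    ∫ r in (0:ℝ)..1, ‖W r‖ ^ 2 * r = (∫ r in (0:ℝ)..1, ‖W r + (m:ℂ)^2 * ψ r‖ ^ 2 * r)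
      + 2 * m ^ 2 * (∫ r in (0:ℝ)..1, ‖P r‖ ^ 2 * r)
      + m ^ 4 * ∫ r in (0:ℝ)..1, ‖ψ r‖ ^ 2 * r := by
  have bi : BC (fun r : ℝ => (r : ℂ)) := BC.id.ofReal
  have bA : BC (fun r => W r + (m:ℂ)^2 * ψ r) := h.bW.add ((BC.const _).mul h.bψ)
  have bg : BC (fun r : ℝ => (r:ℂ) * ((W r + (m:ℂ)^2 * ψ r) * cj (ψ r) + P r * cj (P r))) :=
    bi.mul ((bA.mul h.bψ.conj).add (h.bP.mul h.bP.conj))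
  have e := ftc0 (G := fun r => (r:ℂ) * (P r * cj (ψ r)))
    (g := fun r : ℝ => (r:ℂ) * ((W r + (m:ℂ)^2 * ψ r) * cj (ψ r) + P r * cj (P r)))
    (bi.mul (h.bP.mul h.bψ.conj)).1 ?_ bg (Z0.id.mul (h.bP.mul h.bψ.conj))
  · have e2 := re_int bg
    rw [e] at e2
    simp only [h.ψ_one, map_zero, mul_zero, Complex.zero_re] at e2
    have i1 := (bA.norm.pow.mul BC.id).integrable
    have i2 := (h.bP.norm.pow.mul BC.id).integrable.const_mul (2 * m ^ 2)
    have i3 := (h.bψ.norm.pow.mul BC.id).integrable.const_mul (m ^ 4)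
    have i4 := bg.re.integrable.const_mul (-(2 * m ^ 2))
    rw [← intervalIntegral.integral_const_mul, ← intervalIntegral.integral_const_mul,
      ← intervalIntegral.integral_add i1 i2, ← intervalIntegral.integral_add (i1.add i2) i3]
    have e3 : ∫ r in (0:ℝ)..1, (-(2 * m ^ 2)) *
        ((r:ℂ) * ((W r + (m:ℂ)^2 * ψ r) * cj (ψ r) + P r * cj (P r))).re = 0 := by
      rw [intervalIntegral.integral_const_mul, e2, mul_zero]
    refine Eq.trans ?_ ((congrArg (_ + ·) e3).trans (add_zero _))
    rw [← intervalIntegral.integral_add ((i1.add i2).add i3) i4]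
    congr 1; ext r
    simp only [← Complex.normSq_eq_norm_sq, Complex.normSq_apply, sq (m:ℂ)]
    simp
    ring
  · intro r hr
    have hr0 : (r : ℂ) ≠ 0 := by exact_mod_cast hr.1.ne'
    have dψ := h.dψ r hr
    refine ((hasDerivAt_ofReal' r).mul ((h.dP r hr).mul (hasDerivAt_conj dψ))).congr_deriv ?_
    simp only [h.hP, map_add, map_mul, map_inv₀, Complex.conj_ofReal, Pi.mul_apply, Pi.pow_apply]
    field_simp
    ring

/-- Hardy type inequality -/
theorem Data.hardy (h : Data m c u α Fr Fz Fz1 ψ ψ1 P W W1 W2) :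
    4 * ∫ r in (0:ℝ)..1, ‖ψ r‖ ^ 2 * r ≤ ∫ r in (0:ℝ)..1, (1 - r ^ 2) * (‖P r‖ ^ 2 * r) := by
  have bi : BC (fun r : ℝ => (r : ℂ)) := BC.id.ofReal
  have b1 : BC (fun r : ℝ => 1 - (r:ℂ) ^ 2) := (BC.const 1).sub bi.pow
  have b1' : BC (fun r : ℝ => 1 - r ^ 2) := (BC.const 1).sub BC.id.pow
  have bg : BC (fun r : ℝ => (1 - (r:ℂ)^2) * (ψ1 r * cj (ψ r) + ψ r * cj (ψ1 r))
      - 2 * r * (ψ r * cj (ψ r))) :=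
    (b1.mul ((h.bψ1.mul h.bψ.conj).add (h.bψ.mul h.bψ1.conj))).sub
      (((BC.const _).mul bi).mul (h.bψ.mul h.bψ.conj))
  have e := ftc0 (G := fun r => (1 - (r:ℂ)^2) * (ψ r * cj (ψ r)))
    (g := fun r : ℝ => (1 - (r:ℂ)^2) * (ψ1 r * cj (ψ r) + ψ r * cj (ψ1 r))
      - 2 * r * (ψ r * cj (ψ r)))
    (b1.mul (h.bψ.mul h.bψ.conj)).1 ?_ bg ?_
  · have e2 := re_int bg
    rw [e] at e2
    simp only [h.ψ_one, zero_mul, mul_zero, Complex.zero_re] at e2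
    have b2 := (BC.const (4:ℝ)).mul (h.bψ.norm.pow.mul BC.id)
    have b3 := (BC.const (2:ℝ)).mul bg.re
    have : (4 * ∫ r in (0:ℝ)..1, ‖ψ r‖ ^ 2 * r) = ∫ r in (0:ℝ)..1, (4 * (‖ψ r‖ ^ 2 * r)
       + 2 * ((1 - (r:ℂ)^2) * (ψ1 r * cj (ψ r) + ψ r * cj (ψ1 r))
      - 2 * r * (ψ r * cj (ψ r))).re) := by
      rw [intervalIntegral.integral_add b2.integrable b3.integrable,
        intervalIntegral.integral_const_mul, intervalIntegral.integral_const_mul, e2]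
      ring
    rw [this]
    refine int_mono (b2.add b3) (b1'.mul (h.bP.norm.pow.mul BC.id)) fun r hr => ?_
    have hr0 : (r : ℂ) ≠ 0 := by exact_mod_cast hr.1.ne'
    have hr0' := hr.1.ne'
    have key : (1 - r ^ 2) * (‖P r‖ ^ 2 * r) - (4 * (‖ψ r‖ ^ 2 * r)
       + 2 * ((1 - (r:ℂ)^2) * (ψ1 r * cj (ψ r) + ψ r * cj (ψ1 r))
      - 2 * r * (ψ r * cj (ψ r))).re) = (1 - r ^ 2) * r * ‖ψ1 r - (r:ℂ)⁻¹ * ψ r‖ ^ 2 := by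
      simp only [h.hP, ← Complex.ofReal_inv, ← Complex.normSq_eq_norm_sq, Complex.normSq_apply,
        sq (r : ℂ)]
      simp
      field_simp
      ring
    have h1 : 0 ≤ 1 - r ^ 2 := by nlinarith [hr.1, hr.2]
    have : 0 ≤ (1 - r ^ 2) * r * ‖ψ1 r - (r:ℂ)⁻¹ * ψ r‖ ^ 2 :=
      mul_nonneg (mul_nonneg h1 hr.1.le) (sq_nonneg _)
    linarith
  · intro r hr
    have dψ := h.dψ r hr
    refine ((((hasDerivAt_ofReal' r).pow 2).const_sub 1).mul
      (dψ.mul (hasDerivAt_conj dψ))).congr_deriv ?_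
    simp only [Pi.mul_apply, Pi.pow_apply]
    push_cast
    ring
  · have := h.zψ.mul (h.bψ.conj.mul b1)
    refine this.congr fun r => ?_
    ring

/-- The right hand side functional. -/
theorem Data.bR (h : Data m c u α Fr Fz Fz1 ψ ψ1 P W W1 W2) :
    BC (fun r => (|m| * (‖Fr r‖ * ‖ψ r‖) + ‖Fz r‖ * ‖P r‖) * r) :=
  (((BC.const _).mul (h.bFr.norm.mul h.bψ.norm)).add (h.bFz.norm.mul h.bP.norm)).mul BC.id

theorem Data.bS (h : Data m c u α Fr Fz Fz1 ψ ψ1 P W W1 W2) :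
    BC (fun r : ℝ => Complex.I * m * r * (Fr r * cj (ψ r)) + r * (Fz r * cj (P r))) :=
  (((BC.const _).mul BC.id.ofReal).mul (h.bFr.mul h.bψ.conj)).add
    (BC.id.ofReal.mul (h.bFz.mul h.bP.conj))

theorem norm_S {r : ℝ} (hr : 0 ≤ r) (a b d e : ℂ) :
    ‖Complex.I * m * r * (a * cj b) + r * (d * cj e)‖ ≤ (|m| * (‖a‖ * ‖b‖) + ‖d‖ * ‖e‖) * r := by
  refine (norm_add_le _ _).trans (le_of_eq ?_)
  simp [abs_of_nonneg hr]
  ring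

theorem Data.split (h : Data m c u α Fr Fz Fz1 ψ ψ1 P W W1 W2) :
    ∫ r in (0:ℝ)..1, (Complex.I * ((m * (c * r ^ 2) : ℝ) * (P r * cj (ψ r))
        - (m * ((u - c * r ^ 2 / 2) * ‖P r‖ ^ 2 * r + m ^ 2 * ((u - c * r ^ 2 / 2) * ‖ψ r‖ ^ 2 * r)) : ℝ))
      - (‖W r‖ ^ 2 * r : ℝ) - (Complex.I * m * r * (Fr r * cj (ψ r)) + r * (Fz r * cj (P r))))
    = (α * ‖ψ1 1‖ ^ 2 : ℝ) := by
  have e := h.main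
  simp only [Complex.mul_conj'] at e
  push_cast at e ⊢
  rw [← e]
  congr 1; ext r
  ring

theorem Data.imag (h : Data m c u α Fr Fz Fz1 ψ ψ1 P W W1 W2) :
    |m| * ((∫ r in (0:ℝ)..1, (u - c * r ^ 2 / 2) * ‖P r‖ ^ 2 * r)
      + m ^ 2 * ∫ r in (0:ℝ)..1, (u - c * r ^ 2 / 2) * ‖ψ r‖ ^ 2 * r)
    ≤ ∫ r in (0:ℝ)..1, (|m| * (‖Fr r‖ * ‖ψ r‖) + ‖Fz r‖ * ‖P r‖) * r := by
  have bX := (((bU u c).mul h.bP.norm.pow).mul BC.id)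
  have bY := (((bU u c).mul h.bψ.norm.pow).mul BC.id)
  have bq := bX.add ((BC.const (m^2)).mul bY)
  have bq' := (BC.const m).mul bq
  have bz : BC (fun r : ℝ => m * (c * r ^ 2)) := BC.of_cont (by fun_prop)
  have bT := (((BC.const Complex.I).mul ((bz.ofReal.mul (h.bP.mul h.bψ.conj)).sub bq'.ofReal)).sub
    (h.bW.norm.pow.mul BC.id).ofReal).sub h.bS
  have e := im_int bT
  rw [h.split] at e
  rw [Complex.ofReal_im] at e
  have e2 : ∫ r in (0:ℝ)..1, (m * c * (r ^ 2 * (P r * cj (ψ r)).re)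
      - m * ((u - c * r ^ 2 / 2) * ‖P r‖ ^ 2 * r + m ^ 2 * ((u - c * r ^ 2 / 2) * ‖ψ r‖ ^ 2 * r))
      - (Complex.I * m * r * (Fr r * cj (ψ r)) + r * (Fz r * cj (P r))).im) = 0 := by
    rw [← e]
    congr 1; ext r
    rw [Complex.sub_im, Complex.sub_im, Complex.ofReal_im, Complex.I_mul_im, Complex.sub_re,
      Complex.re_ofReal_mul, Complex.ofReal_re]
    ring
  have bc : BC (fun r : ℝ => r ^ 2 * (P r * cj (ψ r)).re) := BC.id.pow.mul (h.bP.mul h.bψ.conj).re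
  rw [intervalIntegral.integral_sub (((BC.const (m*c)).mul bc).sub bq').integrable h.bS.im.integrable,
    intervalIntegral.integral_sub ((BC.const (m*c)).mul bc).integrable bq'.integrable,
    intervalIntegral.integral_const_mul, h.cross, intervalIntegral.integral_const_mul,
    intervalIntegral.integral_add bX.integrable ((BC.const (m^2)).mul bY).integrable,
    intervalIntegral.integral_const_mul] at e2
  set Q := (∫ r in (0:ℝ)..1, (u - c * r ^ 2 / 2) * ‖P r‖ ^ 2 * r)
      + m ^ 2 * ∫ r in (0:ℝ)..1, (u - c * r ^ 2 / 2) * ‖ψ r‖ ^ 2 * r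
  have e3 : m * Q = -∫ r in (0:ℝ)..1,
    (Complex.I * m * r * (Fr r * cj (ψ r)) + r * (Fz r * cj (P r))).im := by linarith
  calc |m| * Q ≤ |m| * |Q| := mul_le_mul_of_nonneg_left (le_abs_self _) (abs_nonneg _)
    _ = |m * Q| := (abs_mul _ _).symm
    _ ≤ ∫ r in (0:ℝ)..1, |(Complex.I * m * r * (Fr r * cj (ψ r)) + r * (Fz r * cj (P r))).im| := by
      rw [e3, abs_neg]
      exact intervalIntegral.abs_integral_le_integral_abs zero_le_one
    _ ≤ _ := int_mono h.bS.im.norm h.bR fun r hr =>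
      (Complex.abs_im_le_norm _).trans (norm_S hr.1.le _ _ _ _)

theorem Data.real (h : Data m c u α Fr Fz Fz1 ψ ψ1 P W W1 W2) :
    (∫ r in (0:ℝ)..1, ‖W r‖ ^ 2 * r) + α * ‖ψ1 1‖ ^ 2
    ≤ |m * c| * (∫ r in (0:ℝ)..1, ‖P r‖ * ‖ψ r‖ * r)
      + ∫ r in (0:ℝ)..1, (|m| * (‖Fr r‖ * ‖ψ r‖) + ‖Fz r‖ * ‖P r‖) * r := by
  have bX := (((bU u c).mul h.bP.norm.pow).mul BC.id)
  have bY := (((bU u c).mul h.bψ.norm.pow).mul BC.id)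
  have bq := bX.add ((BC.const (m^2)).mul bY)
  have bq' := (BC.const m).mul bq
  have bz : BC (fun r : ℝ => m * (c * r ^ 2)) := BC.of_cont (by fun_prop)
  have bT := (((BC.const Complex.I).mul ((bz.ofReal.mul (h.bP.mul h.bψ.conj)).sub bq'.ofReal)).sub
    (h.bW.norm.pow.mul BC.id).ofReal).sub h.bS
  have e := re_int bT
  rw [h.split] at e
  rw [Complex.ofReal_re] at e
  have bWW := h.bW.norm.pow.mul BC.id
  have bPψ := (BC.const (|m * c|)).mul ((h.bP.norm.mul h.bψ.norm).mul BC.id)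
  rw [← e, ← intervalIntegral.integral_add bWW.integrable bT.re.integrable,
    ← intervalIntegral.integral_const_mul,
    ← intervalIntegral.integral_add bPψ.integrable h.bR.integrable]
  refine int_mono (bWW.add bT.re) (bPψ.add h.bR) fun r hr => ?_
  rw [Complex.sub_re, Complex.sub_re, Complex.ofReal_re, Complex.I_mul_re, Complex.sub_im,
      Complex.im_ofReal_mul, Complex.ofReal_im]
  have h1 := (Complex.abs_re_le_norm _).trans (norm_S (m := m) hr.1.le (Fr r) (ψ r) (Fz r) (P r))
  have h2 : |m * (c * r ^ 2) * (P r * cj (ψ r)).im| ≤ |m * c| * (‖P r‖ * ‖ψ r‖ * r) := by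
    have h3 : |(P r * cj (ψ r)).im| ≤ ‖P r‖ * ‖ψ r‖ := by
      simpa using Complex.abs_im_le_norm (P r * cj (ψ r))
    have h4 : |r| * r ≤ r := by rw [abs_of_pos hr.1]; nlinarith [hr.1, hr.2]
    rw [show m * (c * r ^ 2) = (m * c) * (r ^ 2) by ring, abs_mul, abs_mul, mul_assoc, abs_sq]
    refine mul_le_mul_of_nonneg_left ?_ (abs_nonneg _)
    rw [mul_comm (r^2)]
    refine mul_le_mul h3 ?_ (sq_nonneg _) (by positivity)
    nlinarith [hr.1, hr.2]
  have h3 := neg_le_of_abs_le h1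
  have h4 := neg_le_of_abs_le h2
  linarith

end

section
variable {m c u α : ℝ} {Fr Fz Fz1 ψ ψ1 P W W1 W2 : ℝ → ℂ}

theorem young (x y t : ℝ) (ht : 0 < t) : x * y ≤ t / 2 * y ^ 2 + 1 / (2 * t) * x ^ 2 := by
  have : t / 2 * y ^ 2 + 1 / (2 * t) * x ^ 2 - x * y = (t * y - x) ^ 2 / (2 * t) := by
    field_simp; ring
  have h2 : 0 ≤ (t * y - x) ^ 2 / (2 * t) := by positivity
  linarith

theorem Data.young (h : Data m c u α Fr Fz Fz1 ψ ψ1 P W W1 W2) (t : ℝ) (ht : 0 < t) :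
    ∫ r in (0:ℝ)..1, (|m| * (‖Fr r‖ * ‖ψ r‖) + ‖Fz r‖ * ‖P r‖) * r
    ≤ t / 2 * ((∫ r in (0:ℝ)..1, ‖P r‖ ^ 2 * r) + m ^ 2 * ∫ r in (0:ℝ)..1, ‖ψ r‖ ^ 2 * r)
      + 1 / (2 * t) * ∫ r in (0:ℝ)..1, (‖Fr r‖ ^ 2 + ‖Fz r‖ ^ 2) * r := by
  have b1 := h.bP.norm.pow.mul BC.id
  have b2 := (BC.const (m ^ 2)).mul (h.bψ.norm.pow.mul BC.id)
  have b12 := (BC.const (t / 2)).mul (b1.add b2)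
  have b3 := (BC.const (1 / (2 * t))).mul ((h.bFr.norm.pow.add h.bFz.norm.pow).mul BC.id)
  rw [← intervalIntegral.integral_const_mul (m ^ 2),
    ← intervalIntegral.integral_add b1.integrable b2.integrable,
    ← intervalIntegral.integral_const_mul, ← intervalIntegral.integral_const_mul,
    ← intervalIntegral.integral_add b12.integrable b3.integrable]
  refine int_mono h.bR (b12.add b3) fun r hr => ?_
  have y1 := _root_.young ‖Fr r‖ (|m| * ‖ψ r‖) t ht
  have y2 := _root_.young ‖Fz r‖ ‖P r‖ t ht
  rw [mul_pow, sq_abs] at y1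
  have := mul_le_mul_of_nonneg_right (add_le_add y1 y2) hr.1.le
  linarith

theorem Data.young2 (h : Data m c u α Fr Fz Fz1 ψ ψ1 P W W1 W2) (t : ℝ) (ht : 0 < t) :
    ∫ r in (0:ℝ)..1, ‖P r‖ * ‖ψ r‖ * r
    ≤ t / 2 * (∫ r in (0:ℝ)..1, ‖ψ r‖ ^ 2 * r)
      + 1 / (2 * t) * ∫ r in (0:ℝ)..1, ‖P r‖ ^ 2 * r := by
  have b1 := (BC.const (1 / (2 * t))).mul (h.bP.norm.pow.mul BC.id)
  have b2 := (BC.const (t / 2)).mul (h.bψ.norm.pow.mul BC.id)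
  rw [← intervalIntegral.integral_const_mul, ← intervalIntegral.integral_const_mul,
    ← intervalIntegral.integral_add b2.integrable b1.integrable]
  refine int_mono ((h.bP.norm.mul h.bψ.norm).mul BC.id) (b2.add b1) fun r hr => ?_
  have := mul_le_mul_of_nonneg_right (_root_.young ‖P r‖ ‖ψ r‖ t ht) hr.1.le
  linarith

theorem int_nonneg {f : ℝ → ℝ} (hf : ∀ r ∈ Set.Ioo (0:ℝ) 1, 0 ≤ f r) :
    0 ≤ ∫ r in (0:ℝ)..1, f r := by
  rw [intervalIntegral.integral_of_le zero_le_one, integral_Ioc_eq_integral_Ioo]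
  exact setIntegral_nonneg measurableSet_Ioo hf

theorem Data.bounds (h : Data m c u α Fr Fz Fz1 ψ ψ1 P W W1 W2) (k c0 : ℝ) (hk : 1 ≤ k)
    (hc0 : 0 < c0) (hU1 : ∀ r ∈ Set.Ioo (0:ℝ) 1, c0 * k ^ 4 ≤ |m| * (u - c * r ^ 2 / 2))
    (hU2 : ∀ r ∈ Set.Ioo (0:ℝ) 1, k ^ 6 / 4 * (1 - r ^ 2) ≤ |m| * (u - c * r ^ 2 / 2))
    (hmc : |m * c| ≤ 2 * k ^ 6) {Sψ SP QP Qψ SA F2 : ℝ}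
    (eSψ : Sψ = ∫ r in (0:ℝ)..1, ‖ψ r‖ ^ 2 * r)
    (eSP : SP = ∫ r in (0:ℝ)..1, ‖P r‖ ^ 2 * r)
    (eQP : QP = ∫ r in (0:ℝ)..1, (u - c * r ^ 2 / 2) * ‖P r‖ ^ 2 * r)
    (eQψ : Qψ = ∫ r in (0:ℝ)..1, (u - c * r ^ 2 / 2) * ‖ψ r‖ ^ 2 * r)
    (eSA : SA = ∫ r in (0:ℝ)..1, ‖W r + (m:ℂ)^2 * ψ r‖ ^ 2 * r)
    (eF2 : F2 = ∫ r in (0:ℝ)..1, (‖Fr r‖ ^ 2 + ‖Fz r‖ ^ 2) * r) :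
    Sψ ≤ (1 / c0 + 1 / c0 ^ 2) / k ^ 10 * F2 ∧
    SP + m ^ 2 * Sψ ≤ (1 / c0 + 1 / c0 ^ 2) / k ^ 8 * F2 ∧
    |m| * (QP + m ^ 2 * Qψ) ≤ (1 / c0 + 1 / c0 ^ 2) / k ^ 4 * F2 ∧
    SA + m ^ 2 * SP + m ^ 4 * Sψ + α * ‖ψ1 1‖ ^ 2 ≤ (2 / c0 + 1 / c0 ^ 2) / k ^ 3 * F2 := by
  have k0 : 0 < k := by linarith
  have nF : 0 ≤ F2 := eF2 ▸ int_nonneg fun r hr => mul_nonneg (by positivity) hr.1.le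
  have nψ : 0 ≤ Sψ := eSψ ▸ int_nonneg fun r hr => mul_nonneg (by positivity) hr.1.le
  have nP : 0 ≤ SP := eSP ▸ int_nonneg fun r hr => mul_nonneg (by positivity) hr.1.le
  have im := h.imag
  have re := h.real
  have yg := h.young (c0 * k ^ 4) (by positivity)
  have y2 := h.young2 k k0
  have hd := h.hardy
  rw [h.expand] at re
  rw [← eQP, ← eQψ] at im
  rw [← eSA, ← eSP, ← eSψ] at re
  rw [← eSP, ← eSψ, ← eF2] at yg
  rw [← eSP, ← eSψ] at y2
  rw [← eSψ] at hd
  set R := ∫ r in (0:ℝ)..1, (|m| * (‖Fr r‖ * ‖ψ r‖) + ‖Fz r‖ * ‖P r‖) * r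
  have bP := h.bP.norm.pow.mul BC.id
  have bψ := h.bψ.norm.pow.mul BC.id
  have bQP := ((bU u c).mul h.bP.norm.pow).mul BC.id
  have bQψ := ((bU u c).mul h.bψ.norm.pow).mul BC.id
  have b1' : BC (fun r : ℝ => 1 - r ^ 2) := (BC.const 1).sub BC.id.pow
  have lP : c0 * k ^ 4 * SP ≤ |m| * QP := by
    rw [eSP, eQP, ← intervalIntegral.integral_const_mul, ← intervalIntegral.integral_const_mul]
    refine int_mono ((BC.const _).mul bP) ((BC.const _).mul bQP) fun r hr => ?_
    have := mul_le_mul_of_nonneg_right (hU1 r hr) (mul_nonneg (sq_nonneg ‖P r‖) hr.1.le)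
    linarith
  have lψ : c0 * k ^ 4 * Sψ ≤ |m| * Qψ := by
    rw [eSψ, eQψ, ← intervalIntegral.integral_const_mul, ← intervalIntegral.integral_const_mul]
    refine int_mono ((BC.const _).mul bψ) ((BC.const _).mul bQψ) fun r hr => ?_
    have := mul_le_mul_of_nonneg_right (hU1 r hr) (mul_nonneg (sq_nonneg ‖ψ r‖) hr.1.le)
    linarith
  have lH : k ^ 6 / 4 * (4 * Sψ) ≤ |m| * QP := by
    refine (mul_le_mul_of_nonneg_left hd (by positivity)).trans ?_
    rw [eQP, ← intervalIntegral.integral_const_mul, ← intervalIntegral.integral_const_mul]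
    refine int_mono ((BC.const _).mul (b1'.mul bP)) ((BC.const _).mul bQP) fun r hr => ?_
    have := mul_le_mul_of_nonneg_right (hU2 r hr) (mul_nonneg (sq_nonneg ‖P r‖) hr.1.le)
    linarith
  have nQψ : 0 ≤ |m| * Qψ := le_trans (by positivity) lψ
  set NQ := |m| * (QP + m ^ 2 * Qψ) with hNQ
  have hX : c0 * k ^ 4 * (SP + m ^ 2 * Sψ) ≤ NQ := by
    have := mul_le_mul_of_nonneg_left lψ (sq_nonneg m)
    rw [hNQ]; linarith
  have hH : k ^ 6 * Sψ ≤ NQ := by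
    have := mul_nonneg (sq_nonneg m) nQψ
    rw [hNQ]; linarith
  have hN : NQ ≤ 1 / (c0 * k ^ 4) * F2 := by
    have : 1 / (2 * (c0 * k ^ 4)) * F2 = (1 / (c0 * k ^ 4) * F2) / 2 := by field_simp
    rw [this] at yg
    linarith
  have hR : R ≤ 1 / (c0 * k ^ 4) * F2 := by
    have : 1 / (2 * (c0 * k ^ 4)) * F2 = (1 / (c0 * k ^ 4) * F2) / 2 := by field_simp
    rw [this] at yg
    linarith
  have r1 : Sψ ≤ 1 / c0 / k ^ 10 * F2 := by
    have h1 := hH.trans hN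
    have : Sψ ≤ 1 / (c0 * k ^ 4) * F2 / k ^ 6 := by
      rw [le_div_iff₀ (by positivity)]; linarith
    refine this.trans (le_of_eq ?_)
    field_simp
  have r2 : SP + m ^ 2 * Sψ ≤ 1 / c0 ^ 2 / k ^ 8 * F2 := by
    have h1 := hX.trans hN
    have : SP + m ^ 2 * Sψ ≤ 1 / (c0 * k ^ 4) * F2 / (c0 * k ^ 4) := by
      rw [le_div_iff₀ (by positivity)]; linarith
    refine this.trans (le_of_eq ?_)
    field_simp
  have r3 : SP ≤ 1 / c0 ^ 2 / k ^ 8 * F2 := by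
    have : 0 ≤ m ^ 2 * Sψ := by positivity
    linarith
  refine ⟨r1.trans ?_, r2.trans ?_, hN.trans ?_, ?_⟩
  · gcongr; have : 0 < 1 / c0 ^ 2 := by positivity
    linarith
  · gcongr; have : 0 < 1 / c0 := by positivity
    linarith
  · rw [← div_div]; gcongr; have : 0 < 1 / c0 ^ 2 := by positivity
    linarith
  · have nI : 0 ≤ ∫ r in (0:ℝ)..1, ‖P r‖ * ‖ψ r‖ * r :=
      int_nonneg fun r hr => mul_nonneg (by positivity) hr.1.le
    have s1 := mul_le_mul hmc y2 nI (by positivity)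
    have s2 : 2 * k ^ 6 * (k / 2 * Sψ + 1 / (2 * k) * SP) = k ^ 7 * Sψ + k ^ 5 * SP := by
      field_simp
    have s3 : k ^ 7 * Sψ ≤ 1 / c0 / k ^ 3 * F2 := by
      refine (mul_le_mul_of_nonneg_left r1 (by positivity)).trans (le_of_eq ?_)
      field_simp
    have s4 : k ^ 5 * SP ≤ 1 / c0 ^ 2 / k ^ 3 * F2 := by
      refine (mul_le_mul_of_nonneg_left r3 (by positivity)).trans (le_of_eq ?_)
      field_simp
    have s5 : 1 / (c0 * k ^ 4) * F2 ≤ 1 / c0 / k ^ 3 * F2 := by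
      rw [← div_div]; gcongr
      norm_num
    have s6 : 0 ≤ m ^ 2 * SP := by positivity
    have s7 : (2 / c0 + 1 / c0 ^ 2) / k ^ 3 * F2 = 1 / c0 / k ^ 3 * F2 + 1 / c0 / k ^ 3 * F2
      + 1 / c0 ^ 2 / k ^ 3 * F2 := by ring
    rw [s7]
    linarith

end

theorem wInt_congr {f g : ℝ → ℝ} (h : ∀ r ∈ Set.Ioo (0:ℝ) 1, f r = g r) : wInt f = wInt g := by
  unfold wInt
  exact setLIntegral_congr_fun measurableSet_Ioo (fun r hr => by simp only [h r hr])

theorem wInt_eq {f : ℝ → ℝ} (hf : BC f) (h0 : ∀ r ∈ Set.Ioo (0:ℝ) 1, 0 ≤ f r) :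
    wInt f = ENNReal.ofReal (∫ r in (0:ℝ)..1, f r) := by
  unfold wInt
  rw [intervalIntegral.integral_of_le zero_le_one, integral_Ioc_eq_integral_Ioo,
    ofReal_integral_eq_lintegral_ofReal]
  · exact ((intervalIntegrable_iff_integrableOn_Ioc_of_le zero_le_one).1 hf.integrable).mono_set
      Set.Ioo_subset_Ioc_self
  · exact (ae_restrict_iff' measurableSet_Ioo).2 (Eventually.of_forall h0)

theorem BC.congr {f g : ℝ → ℂ} (hf : BC f) (h : ∀ r ∈ Set.Ioc (0:ℝ) 1, g r = f r) : BC g := by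
  obtain ⟨cf, M, hM⟩ := hf
  exact ⟨cf.congr h, M, fun r hr => by rw [h r hr]; exact hM r hr⟩

theorem dz_contDiff {g : ℝ → ℂ} {k l : ℕ} (hg : ContDiffOn ℝ k g (Set.Ioc 0 1)) (hl : l + 1 ≤ k) :
    ContDiffOn ℝ l (dz g) (Set.Ioc 0 1) :=
  hg.derivWithin (uniqueDiffOn_Ioc 0 1) (by exact_mod_cast hl)

theorem dz_hasDeriv {g : ℝ → ℂ} (hg : DifferentiableOn ℝ g (Set.Ioc 0 1)) :
    ∀ r ∈ Set.Ioo (0:ℝ) 1, HasDerivAt g (dz g r) r := fun r hr =>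
  (hg r (Set.Ioo_subset_Ioc_self hr)).hasDerivWithinAt.hasDerivAt (Ioc_mem_nhds hr.1 hr.2)

theorem cast_contDiff (k : ℕ) : ContDiffOn ℝ k (fun r : ℝ => (r : ℂ)) (Set.Ioc 0 1) :=
  Complex.ofRealCLM.contDiff.contDiffOn

theorem Lop_contDiff {g : ℝ → ℂ} (hg : ContDiffOn ℝ (4:ℕ) g (Set.Ioc 0 1)) :
    ContDiffOn ℝ (2:ℕ) (Lop g) (Set.Ioc 0 1) := by
  have h1 := dz_contDiff hg (l := 3) (by norm_num)
  have h2 := dz_contDiff h1 (l := 2) (by norm_num)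
  have hi := cast_contDiff 2
  have hne : ∀ r ∈ Set.Ioc (0:ℝ) 1, (r:ℂ) ≠ 0 := fun r hr => by exact_mod_cast hr.1.ne'
  exact (h2.add ((hi.inv hne).mul (h1.of_le (by norm_num)))).sub
    (((hi.pow 2).inv (fun r hr => pow_ne_zero 2 (hne r hr))).mul (hg.of_le (by norm_num)))

theorem psi_le {g : ℝ → ℂ} (hg : DifferentiableOn ℝ g (Set.Ioc 0 1))
    (h0 : Tendsto g (nhdsWithin (0 : ℝ) (Set.Ioc 0 1)) (nhds 0)) {M : ℝ}
    (hM : ∀ r ∈ Set.Ioc (0:ℝ) 1, ‖dz g r‖ ≤ M) :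
    ∀ r ∈ Set.Ioc (0:ℝ) 1, ‖g r‖ ≤ M * r := by
  intro r hr
  have key : ∀ x ∈ Set.Ioc (0:ℝ) 1, ‖g r - g x‖ ≤ M * ‖r - x‖ := fun x hx =>
    Convex.norm_image_sub_le_of_norm_hasDerivWithin_le (f' := dz g)
      (fun y hy => (hg y hy).hasDerivWithinAt) hM (convex_Ioc 0 1) hx hr
  have hne : (nhdsWithin (0 : ℝ) (Set.Ioc 0 1)).NeBot := by
    rw [nhdsWithin_Ioc_eq_nhdsGT one_pos]; infer_instance
  have t1 : Tendsto (fun x => ‖g r - g x‖) (nhdsWithin (0 : ℝ) (Set.Ioc 0 1)) (nhds ‖g r - 0‖) :=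
    (h0.const_sub (g r)).norm
  have t2 : Tendsto (fun x : ℝ => M * ‖r - x‖) (nhdsWithin (0 : ℝ) (Set.Ioc 0 1))
      (nhds (M * ‖r - 0‖)) := by
    refine Tendsto.mono_left ?_ nhdsWithin_le_nhds
    exact Continuous.tendsto (by fun_prop) 0
  have := le_of_tendsto_of_tendsto t1 t2 (by
    filter_upwards [self_mem_nhdsWithin] with x hx using key x hx)
  simpa [abs_of_pos hr.1] using this

theorem dz_mul_id {g : ℝ → ℂ} (hg : DifferentiableOn ℝ g (Set.Ioc 0 1)) :
    ∀ r ∈ Set.Ioc (0:ℝ) 1, dz (fun s => (s : ℂ) * g s) r = g r + r * dz g r := by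
  intro r hr
  have h := ((hasDerivAt_ofReal' r).hasDerivWithinAt (s := Set.Ioc 0 1)).mul
    (hg r hr).hasDerivWithinAt
  have := h.derivWithin (uniqueDiffOn_Ioc 0 1 r hr)
  unfold dz
  rw [show (fun s : ℝ => (s : ℂ) * g s) = (fun s : ℝ => (s : ℂ)) * g from rfl, this]
  simp

theorem Ubar_eq (Φ α r : ℝ) (hα : 0 ≤ α) : Ubar Φ α r =
    (4 + 2 * α) / (4 + α) * (Φ / Real.pi) - (4 * α / (4 + α) * (Φ / Real.pi)) * r ^ 2 / 2 := by
  unfold Ubar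
  have : 4 + 2 * α ≠ 0 := by positivity
  have : 4 + α ≠ 0 := by positivity
  field_simp
  ring

theorem toData {Φ α : ℝ} {n : ℤ} {Fr Fz ψ : ℝ → ℂ} (hα : 0 ≤ α)
    (hFr : ContinuousOn Fr (Set.Icc 0 1)) (hFz : ContDiffOn ℝ 1 Fz (Set.Icc 0 1))
    (h : NavierSol Φ α n (fun r => Complex.I * (n : ℂ) * Fr r - dz Fz r) ψ) :
    Data (n : ℝ) (4 * α / (4 + α) * (Φ / Real.pi)) ((4 + 2 * α) / (4 + α) * (Φ / Real.pi)) α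
      Fr Fz (dz Fz) ψ (dz ψ) (fun r => dz ψ r + (r : ℂ)⁻¹ * ψ r)
      (fun s => Lop ψ s - (n : ℂ) ^ 2 * ψ s)
      (dz (fun s => Lop ψ s - (n : ℂ) ^ 2 * ψ s))
      (dz (dz (fun s => Lop ψ s - (n : ℂ) ^ 2 * ψ s))) := by
  have c4 : ContDiffOn ℝ (4:ℕ) ψ (Set.Ioc 0 1) := by exact_mod_cast h.smooth
  have c3 := dz_contDiff c4 (l := 3) (by norm_num)
  have cL := Lop_contDiff c4
  have cW : ContDiffOn ℝ (2:ℕ) (fun s => Lop ψ s - (n : ℂ) ^ 2 * ψ s) (Set.Ioc 0 1) :=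
    cL.sub (contDiffOn_const.mul (c4.of_le (by norm_num)))
  have cW1 := dz_contDiff cW (l := 1) (by norm_num)
  have dψ : DifferentiableOn ℝ ψ (Set.Ioc 0 1) := c4.differentiableOn (by norm_num)
  have dL : DifferentiableOn ℝ (Lop ψ) (Set.Ioc 0 1) := cL.differentiableOn (by norm_num)
  have dFz : DifferentiableOn ℝ Fz (Set.Ioc 0 1) :=
    (hFz.differentiableOn (by norm_num)).mono Set.Ioc_subset_Icc_self
  have bψ : BC ψ := BC.of_tendsto c4.continuousOn h.ext_psi
  have bψ1 : BC (dz ψ) := by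
    obtain ⟨L, hL⟩ := h.ext_dpsi
    exact BC.of_tendsto c3.continuousOn hL
  have bL : BC (Lop ψ) := BC.of_tendsto cL.continuousOn h.ext_Lpsi
  have crL : ContDiffOn ℝ (2:ℕ) (fun r : ℝ => (r:ℂ) * Lop ψ r) (Set.Ioc 0 1) :=
    (cast_contDiff 2).mul cL
  have brL : BC (dz (fun r => (r : ℂ) * Lop ψ r)) := by
    obtain ⟨L, hL⟩ := h.ext_dLpsi
    exact BC.of_tendsto (dz_contDiff crL (l := 1) (by norm_num)).continuousOn hL
  have hne : ∀ r ∈ Set.Ioc (0:ℝ) 1, (r:ℂ) ≠ 0 := fun r hr => by exact_mod_cast hr.1.ne'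
  have bq : BC (fun r : ℝ => (r : ℂ)⁻¹ * ψ r) := by
    obtain ⟨_, M, hM⟩ := bψ1
    refine ⟨((cast_contDiff 0).continuousOn.inv₀ hne).mul c4.continuousOn, M, fun r hr => ?_⟩
    have := psi_le dψ h.ext_psi hM r hr
    rw [norm_mul, norm_inv, Complex.norm_real, Real.norm_of_nonneg hr.1.le, inv_mul_le_iff₀ hr.1]
    linarith
  exact
  { cψ := c4.continuousOn
    cψ1 := c3.continuousOn
    cW1 := cW1.continuousOn
    bW := bL.sub ((BC.const _).mul bψ)
    bFr := BC.of_cont hFr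
    bFz := BC.of_cont hFz.continuousOn
    bψ1 := bψ1
    hP := fun r => rfl
    bP := bψ1.add bq
    brW1 := by
      refine ((brL.sub bL).sub ((BC.const ((n:ℂ)^2)).mul (BC.id.ofReal.mul bψ1))).congr ?_
      intro r hr
      rw [dz_mul_id dL r hr]
      have : dz (fun s => Lop ψ s - (n : ℂ) ^ 2 * ψ s) r = dz (Lop ψ) r - (n:ℂ)^2 * dz ψ r :=
        ((dL r hr).hasDerivWithinAt.sub ((dψ r hr).hasDerivWithinAt.const_mul ((n:ℂ)^2))).derivWithin
          (uniqueDiffOn_Ioc 0 1 r hr)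
      rw [this]
      ring
    zψ := by
      have := h.ext_psi
      rwa [nhdsWithin_Ioc_eq_nhdsGT one_pos] at this
    dψ := dz_hasDeriv dψ
    dψ1 := by
      intro r hr
      refine (dz_hasDeriv (c3.differentiableOn (by norm_num)) r hr).congr_deriv ?_
      simp only [Lop, Complex.ofReal_intCast]
      ring
    dW := dz_hasDeriv (cW.differentiableOn (by norm_num))
    dW1 := dz_hasDeriv (cW1.differentiableOn (by norm_num))
    dFz := dz_hasDeriv dFz
    ψ_one := h.bc_psi
    W_one := by simp [h.bc_psi, h.bc_navier]
    eqn := by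
      intro r hr
      have := h.eqn r hr
      rw [Ubar_eq Φ α r hα] at this
      simp only [Complex.ofReal_intCast]
      rw [← this]
      congr 2 }

/-- Proposition 3.7: the case of large flux, intermediate frequency and intermediate
slip coefficient. For `ε₁, δ ∈ (0,1)` there are `Φ₀, C > 0` (depending only on
`ε₁, δ`) such that for `Φ ≥ Φ₀`, `1 ≤ |n| ≤ ε₁√Φ`,
`δ(Φ|n|)^{1/3} ≤ 4+α ≤ δ⁻¹(Φ|n|)^{1/3}`, and `f = i n F^r − (F^z)'`,
the four stated estimates hold, with `‖F*‖² = ∫₀¹ (|F^r|²+|F^z|²) r dr`. -/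
theorem intermediate_case_estimate (ε₁ δ : ℝ)
    (hε₁0 : 0 < ε₁) (hε₁1 : ε₁ < 1) (hδ0 : 0 < δ) (hδ1 : δ < 1) :
    ∃ Φ₀ C : ℝ, 0 < Φ₀ ∧ 0 < C ∧ ∀ (Φ α : ℝ) (n : ℤ) (Fr Fz ψ : ℝ → ℂ),
      Φ₀ ≤ Φ →
      1 ≤ |(n : ℝ)| → |(n : ℝ)| ≤ ε₁ * Real.sqrt Φ →
      0 ≤ α →
      δ * (Φ * |(n : ℝ)|) ^ ((1 : ℝ) / 3) ≤ 4 + α →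
      4 + α ≤ δ⁻¹ * (Φ * |(n : ℝ)|) ^ ((1 : ℝ) / 3) →
      ContinuousOn Fr (Set.Icc 0 1) → ContDiffOn ℝ 1 Fz (Set.Icc 0 1) →
      NavierSol Φ α n (fun r => Complex.I * (n : ℂ) * Fr r - dz Fz r) ψ →
      (wInt (fun r => ‖ψ r‖ ^ 2 * r)
        ≤ ENNReal.ofReal (C * (Φ * |(n : ℝ)|) ^ (-(5 / 3) : ℝ))
            * wInt (fun r => (‖Fr r‖ ^ 2 + ‖Fz r‖ ^ 2) * r)) ∧
      (wInt (fun r => ‖dz (fun s => (s : ℂ) * ψ s) r‖ ^ 2 / r)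
          + ENNReal.ofReal ((n : ℝ) ^ 2) * wInt (fun r => ‖ψ r‖ ^ 2 * r)
        ≤ ENNReal.ofReal (C * (Φ * |(n : ℝ)|) ^ (-(4 / 3) : ℝ))
            * wInt (fun r => (‖Fr r‖ ^ 2 + ‖Fz r‖ ^ 2) * r)) ∧
      (ENNReal.ofReal |(n : ℝ)|
          * wInt (fun r => Ubar Φ α r * ‖dz (fun s => (s : ℂ) * ψ s) r‖ ^ 2 / r)
          + ENNReal.ofReal (|(n : ℝ)| ^ 3)
              * wInt (fun r => Ubar Φ α r * ‖ψ r‖ ^ 2 * r)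
        ≤ ENNReal.ofReal (C * (Φ * |(n : ℝ)|) ^ (-(2 / 3) : ℝ))
            * wInt (fun r => (‖Fr r‖ ^ 2 + ‖Fz r‖ ^ 2) * r)) ∧
      (wInt (fun r => ‖Lop ψ r‖ ^ 2 * r)
          + ENNReal.ofReal ((n : ℝ) ^ 2)
              * wInt (fun r => ‖dz (fun s => (s : ℂ) * ψ s) r‖ ^ 2 / r)
          + ENNReal.ofReal ((n : ℝ) ^ 4) * wInt (fun r => ‖ψ r‖ ^ 2 * r)
          + ENNReal.ofReal (α * ‖dz ψ 1‖ ^ 2)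
        ≤ ENNReal.ofReal (C * (Φ * |(n : ℝ)|) ^ (-(1 / 2) : ℝ))
            * wInt (fun r => (‖Fr r‖ ^ 2 + ‖Fz r‖ ^ 2) * r)) := by
  refine ⟨(8 / δ) ^ 3, 2 / δ + 1 / δ ^ 2, by positivity, by positivity, ?_⟩
  intro Φ α n Fr Fz ψ hΦ hn1 _ hα hl hu hFr hFz hsol
  have D := toData hα hFr hFz hsol
  have hδ8 : 8 ≤ 8 / δ := by rw [le_div_iff₀ hδ0]; nlinarith
  have hΦ1 : 1 ≤ Φ := by
    have : (1:ℝ) ≤ (8 / δ) ^ 3 := one_le_pow₀ (by linarith)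
    linarith
  set m : ℝ := (n : ℝ) with hm
  set K : ℝ := Φ * |m| with hK
  have hKΦ : Φ ≤ K := by rw [hK]; nlinarith
  have hK0 : 0 < K := by linarith
  set k : ℝ := K ^ ((1:ℝ) / 6) with hk
  have hk0 : 0 < k := Real.rpow_pos_of_pos hK0 _
  have hk1 : 1 ≤ k := Real.one_le_rpow (by linarith) (by norm_num)
  have hpow : ∀ j : ℕ, k ^ j = K ^ ((j:ℝ) / 6) := fun j => by
    rw [hk, ← Real.rpow_natCast, ← Real.rpow_mul hK0.le]; congr 1; ring
  have hk6 : k ^ 6 = K := by rw [hpow]; norm_num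
  have hk2 : K ^ ((1:ℝ) / 3) = k ^ 2 := by rw [hpow]; norm_num
  have hneg : ∀ (j : ℕ) (x : ℝ), x = -((j:ℝ) / 6) → K ^ x = (k ^ j)⁻¹ := fun j x hx => by
    rw [hx, Real.rpow_neg hK0.le, hpow]
  rw [hk2] at hl hu
  rw [hneg 10 (-(5/3)) (by norm_num), hneg 8 (-(4/3)) (by norm_num),
    hneg 4 (-(2/3)) (by norm_num), hneg 3 (-(1/2)) (by norm_num)]
  have hk28 : 8 / δ ≤ k ^ 2 := by
    have h6 : (8 / δ) ^ 3 ≤ (k ^ 2) ^ 3 := by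
      rw [← pow_mul, hk6]; linarith
    exact le_of_pow_le_pow_left₀ (by norm_num) (by positivity) h6
  have hα4 : 4 ≤ α := by
    have : 8 ≤ δ * k ^ 2 := by rw [div_le_iff₀ hδ0] at hk28; linarith
    linarith
  have hπ3 := Real.pi_gt_three
  have hπ4 := Real.pi_le_four
  have hUf : ∀ r, Ubar Φ α r = (4 + 2 * α * (1 - r ^ 2)) / (4 + α) * (Φ / Real.pi) := fun r => by
    unfold Ubar
    have : 4 + 2 * α ≠ 0 := by positivity
    have : 4 + α ≠ 0 := by positivity
    field_simp
    ring
  have hmU : ∀ r, |m| * Ubar Φ α r = (4 + 2 * α * (1 - r ^ 2)) / (4 + α) * (k ^ 6 / Real.pi) :=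
    fun r => by rw [hUf, hk6, hK]; ring
  have hπk : k ^ 6 / 4 ≤ k ^ 6 / Real.pi := by gcongr
  have hUpos : ∀ r ∈ Set.Ioo (0:ℝ) 1, 0 ≤ Ubar Φ α r := fun r hr => by
    have h1 : 0 ≤ 1 - r ^ 2 := by nlinarith [hr.1, hr.2]
    rw [hUf]; positivity
  have key := D.bounds k δ hk1 hδ0
    (fun r hr => by
      rw [← Ubar_eq Φ α r hα, hmU]
      have h1 : 0 ≤ 1 - r ^ 2 := by nlinarith [hr.1, hr.2]
      have h2 : 4 * δ / k ^ 2 ≤ (4 + 2 * α * (1 - r ^ 2)) / (4 + α) := by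
        rw [div_le_div_iff₀ (by positivity) (by positivity)]
        have h3 : δ * (4 + α) ≤ k ^ 2 := by
          have := mul_le_mul_of_nonneg_left hu hδ0.le
          rwa [mul_inv_cancel_left₀ hδ0.ne'] at this
        have h4 : 0 ≤ 2 * α * (1 - r ^ 2) * k ^ 2 := by positivity
        linarith
      calc δ * k ^ 4 = 4 * δ / k ^ 2 * (k ^ 6 / 4) := by field_simp
        _ ≤ _ := mul_le_mul h2 hπk (by positivity) (by positivity))
    (fun r hr => by
      rw [← Ubar_eq Φ α r hα, hmU]
      have h1 : 0 ≤ 1 - r ^ 2 := by nlinarith [hr.1, hr.2]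
      have h2 : 1 - r ^ 2 ≤ (4 + 2 * α * (1 - r ^ 2)) / (4 + α) := by
        rw [le_div_iff₀ (by positivity)]
        nlinarith
      rw [mul_comm]
      exact mul_le_mul h2 hπk (by positivity) (by positivity))
    (by
      have h2 : 4 * α / (4 + α) ≤ 4 := by
        rw [div_le_iff₀ (by positivity)]; linarith
      have h3 : k ^ 6 / Real.pi ≤ k ^ 6 / 3 := by gcongr
      have h0 : 0 ≤ 4 * α / (4 + α) * (Φ / Real.pi) := by positivity
      rw [abs_mul, abs_of_nonneg h0]
      calc |m| * (4 * α / (4 + α) * (Φ / Real.pi)) = 4 * α / (4 + α) * (k ^ 6 / Real.pi) := by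
            rw [hk6, hK]; ring
        _ ≤ 4 * (k ^ 6 / 3) := mul_le_mul h2 h3 (by positivity) (by norm_num)
        _ ≤ 2 * k ^ 6 := by have : 0 < k ^ 6 := by positivity
                            linarith)
    rfl rfl rfl rfl rfl rfl
  simp only [← Ubar_eq Φ α _ hα] at key
  have bUbar : BC (Ubar Φ α) := BC.of_cont (by unfold Ubar; fun_prop)
  have dψ : DifferentiableOn ℝ ψ (Set.Ioc 0 1) := hsol.smooth.differentiableOn (by norm_num)
  have hPn : ∀ r ∈ Set.Ioo (0:ℝ) 1, ‖dz (fun s => (s : ℂ) * ψ s) r‖ ^ 2 / r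
      = ‖dz ψ r + (r : ℂ)⁻¹ * ψ r‖ ^ 2 * r := fun r hr => by
    have hr0 : (r : ℂ) ≠ 0 := by exact_mod_cast hr.1.ne'
    have hr0' := hr.1.ne'
    have : ψ r + r * dz ψ r = r * (dz ψ r + (r : ℂ)⁻¹ * ψ r) := by field_simp; ring
    rw [dz_mul_id dψ r (Set.Ioo_subset_Ioc_self hr), this, norm_mul, Complex.norm_real,
      Real.norm_of_nonneg hr.1.le]
    field_simp
  have w1 := wInt_eq (D.bψ.norm.pow.mul BC.id) (fun r hr => mul_nonneg (sq_nonneg _) hr.1.le)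
  have w2 := (wInt_congr hPn).trans
    (wInt_eq (D.bP.norm.pow.mul BC.id) (fun r hr => mul_nonneg (sq_nonneg _) hr.1.le))
  have w3 := wInt_eq ((bUbar.mul D.bψ.norm.pow).mul BC.id)
    (fun r hr => mul_nonneg (mul_nonneg (hUpos r hr) (sq_nonneg _)) hr.1.le)
  have w4 := (wInt_congr (f := fun r => Ubar Φ α r * ‖dz (fun s => (s : ℂ) * ψ s) r‖ ^ 2 / r)
    (fun r hr => by rw [mul_div_assoc, hPn r hr, ← mul_assoc])).trans
    (wInt_eq ((bUbar.mul D.bP.norm.pow).mul BC.id)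
    (fun r hr => mul_nonneg (mul_nonneg (hUpos r hr) (sq_nonneg _)) hr.1.le))
  have w5 := wInt_eq ((D.bFr.norm.pow.add D.bFz.norm.pow).mul BC.id)
    (fun r hr => mul_nonneg (by positivity) hr.1.le)
  have hLn : (fun r => ‖Lop ψ r - (n:ℂ) ^ 2 * ψ r + (m:ℂ) ^ 2 * ψ r‖ ^ 2 * r)
      = fun r => ‖Lop ψ r‖ ^ 2 * r := by
    ext r; rw [hm]; simp
  have bL : BC (fun r => ‖Lop ψ r‖ ^ 2 * r) := by
    rw [← hLn]
    exact (D.bW.add ((BC.const _).mul D.bψ)).norm.pow.mul BC.id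
  have w6 := wInt_eq bL (fun r hr => mul_nonneg (sq_nonneg _) hr.1.le)
  rw [hLn] at key
  rw [w1, w2, w3, w4, w5, w6]
  have i1 := int_nonneg (f := fun r => ‖ψ r‖ ^ 2 * r)
    (fun r hr => mul_nonneg (sq_nonneg _) hr.1.le)
  have i2 := int_nonneg (f := fun r => ‖dz ψ r + (r : ℂ)⁻¹ * ψ r‖ ^ 2 * r)
    (fun r hr => mul_nonneg (sq_nonneg _) hr.1.le)
  have i3 := int_nonneg (f := fun r => Ubar Φ α r * ‖ψ r‖ ^ 2 * r)
    (fun r hr => mul_nonneg (mul_nonneg (hUpos r hr) (sq_nonneg _)) hr.1.le)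
  have i4 := int_nonneg (f := fun r => Ubar Φ α r * ‖dz ψ r + (r : ℂ)⁻¹ * ψ r‖ ^ 2 * r)
    (fun r hr => mul_nonneg (mul_nonneg (hUpos r hr) (sq_nonneg _)) hr.1.le)
  have i5 := int_nonneg (f := fun r => (‖Fr r‖ ^ 2 + ‖Fz r‖ ^ 2) * r)
    (fun r hr => mul_nonneg (by positivity) hr.1.le)
  have i6 := int_nonneg (f := fun r => ‖Lop ψ r‖ ^ 2 * r)
    (fun r hr => mul_nonneg (sq_nonneg _) hr.1.le)
  set Sψ := ∫ r in (0:ℝ)..1, ‖ψ r‖ ^ 2 * r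
  set SP := ∫ r in (0:ℝ)..1, ‖dz ψ r + (r : ℂ)⁻¹ * ψ r‖ ^ 2 * r
  set Qψ := ∫ r in (0:ℝ)..1, Ubar Φ α r * ‖ψ r‖ ^ 2 * r
  set QP := ∫ r in (0:ℝ)..1, Ubar Φ α r * ‖dz ψ r + (r : ℂ)⁻¹ * ψ r‖ ^ 2 * r
  set F2 := ∫ r in (0:ℝ)..1, (‖Fr r‖ ^ 2 + ‖Fz r‖ ^ 2) * r
  set SA := ∫ r in (0:ℝ)..1, ‖Lop ψ r‖ ^ 2 * r
  obtain ⟨k1, k2, k3, k4⟩ := key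
  have hC : ∀ j : ℕ, (1 / δ + 1 / δ ^ 2) / k ^ j * F2 ≤ (2 / δ + 1 / δ ^ 2) * (k ^ j)⁻¹ * F2 := by
    intro j
    rw [div_eq_mul_inv]
    gcongr
    norm_num
  have hm3 : |m| * m ^ 2 = |m| ^ 3 := by rw [← sq_abs m]; ring
  refine ⟨?_, ?_, ?_, ?_⟩
  · rw [← ENNReal.ofReal_mul (by positivity)]
    exact ENNReal.ofReal_le_ofReal (k1.trans (hC 10))
  · rw [← ENNReal.ofReal_mul (by positivity), ← ENNReal.ofReal_mul (by positivity),
      ← ENNReal.ofReal_add (by positivity) (by positivity)]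
    exact ENNReal.ofReal_le_ofReal (k2.trans (hC 8))
  · rw [← ENNReal.ofReal_mul (by positivity), ← ENNReal.ofReal_mul (by positivity),
      ← ENNReal.ofReal_mul (by positivity),
      ← ENNReal.ofReal_add (by positivity) (by positivity), ← hm3]
    refine ENNReal.ofReal_le_ofReal (le_trans (le_of_eq ?_) (k3.trans (hC 4)))
    ring
  · rw [← ENNReal.ofReal_mul (by positivity), ← ENNReal.ofReal_mul (by positivity),
      ← ENNReal.ofReal_mul (by positivity),
      ← ENNReal.ofReal_add (by positivity) (by positivity),
      ← ENNReal.ofReal_add (by positivity) (by positivity),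
      ← ENNReal.ofReal_add (by positivity) (by positivity)]
    rw [div_eq_mul_inv] at k4
    exact ENNReal.ofReal_le_ofReal k4
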